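/- Let A and B be commutative rings, f : A → B a ring homomorphism, J an ideal of B, and 𝒜 a non-empty class of ideals of A. Assume that height f⁻¹(𝔮) ≤ height 𝔮 for every 𝔮 ∈ Spec(B) \ V(J). If A⋈^f J is Cohen-Macaulay in the sense of 𝒜^e := { 𝔞^e : 𝔞 ∈ 𝒜 }, then A is Cohen-Macaulay in the sense of 𝒜 and kgr_A(𝔞, J) ≥ height 𝔞 for every 𝔞 ∈ 𝒜. -/

import Mathlib

/-- The Koszul cochain differential of the complex `Hom(K_•(x), M)`, described explicitly:
the degree-`i` term is the module of `M`-valued functions on the `i`-element subsets of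
`Fin n`, and the differential is the usual alternating-sum formula. -/
noncomputable def koszulMap (A : Type*) [CommRing A] (M : Type*) [AddCommGroup M]
    [Module A M] {n : ℕ} (x : Fin n → A) (i : ℕ) :
    ({s : Finset (Fin n) // s.card = i} → M) →ₗ[A]
      ({s : Finset (Fin n) // s.card = i + 1} → M) where
  toFun g t := ∑ j ∈ t.1.attach,
    (((-1 : A) ^ ((t.1.filter (fun k => k < j.1)).card)) * x j.1) •
      g ⟨t.1.erase j.1, by
        rw [Finset.card_erase_of_mem j.2, t.2]; omega⟩

  map_add' g h := funext fun t => by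
    simp [smul_add, Finset.sum_add_distrib]
  map_smul' a g := funext fun t => by
    simp only [Pi.smul_apply, RingHom.id_apply, Finset.smul_sum]
    exact Finset.sum_congr rfl fun j _ => by
      rw [smul_smul, smul_smul, mul_comm]

/-- Nonvanishing of the `i`-th cohomology `H^i(Hom(K_•(x), M))` of the Koszul
cochain complex. -/
def koszulCohomologyNeZero (A : Type*) [CommRing A] (M : Type*) [AddCommGroup M]
    [Module A M] {n : ℕ} (x : Fin n → A) : ℕ → Prop
  | 0 => LinearMap.ker (koszulMap A M x 0) ≠ ⊥
  | (i + 1) => ¬ (LinearMap.ker (koszulMap A M x (i + 1)) ≤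
      LinearMap.range (koszulMap A M x i))

/-- The Koszul grade of a finite sequence `x` on `M`:
`inf { i : H^i(Hom(K_•(x), M)) ≠ 0 }` (an element of `ℕ∞`, equal to `⊤` if all
cohomology vanishes). -/
noncomputable def kgrSeq (A : Type*) [CommRing A] (M : Type*) [AddCommGroup M]
    [Module A M] {n : ℕ} (x : Fin n → A) : ℕ∞ :=
  sInf {i : ℕ∞ | ∃ k : ℕ, i = k ∧ koszulCohomologyNeZero A M x k}

/-- The Koszul grade `kgr_A(𝔞, M)` of an arbitrary ideal `𝔞` on `M`: the supremum of the
Koszul grades of finite sequences contained in `𝔞` (equivalently, of the finitely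
generated subideals of `𝔞`). -/
noncomputable def kgr (A : Type*) [CommRing A] (𝔞 : Ideal A) (M : Type*)
    [AddCommGroup M] [Module A M] : ℕ∞ :=
  ⨆ (n : ℕ) (x : Fin n → A) (_ : ∀ j, x j ∈ 𝔞), kgrSeq A M x

/-- The height of an ideal: the infimum of the heights of the primes containing it. -/
noncomputable def idealHeight (A : Type*) [CommRing A] (𝔞 : Ideal A) : ℕ∞ :=
  ⨅ (p : PrimeSpectrum A) (_ : 𝔞 ≤ p.asIdeal), Order.height p

/-- A commutative ring `R` is Cohen-Macaulay in the sense of a class `𝒜` of ideals if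
`height 𝔞 = kgr_R(𝔞, R)` for every `𝔞 ∈ 𝒜`. -/
def IsCMSense (R : Type*) [CommRing R] (𝒜 : Set (Ideal R)) : Prop :=
  ∀ 𝔞 ∈ 𝒜, idealHeight R 𝔞 = kgr R 𝔞 R

/-- Cohen-Macaulay in the sense of ideals. -/
def IsCMIdeals (R : Type*) [CommRing R] : Prop :=
  ∀ 𝔞 : Ideal R, idealHeight R 𝔞 = kgr R 𝔞 R

/-- Cohen-Macaulay in the sense of maximal ideals. -/
def IsCMMaximal (R : Type*) [CommRing R] : Prop :=
  ∀ 𝔪 : Ideal R, 𝔪.IsMaximal → idealHeight R 𝔪 = kgr R 𝔪 R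

/-- The amalgamation `A ⋈^f J = {(a, f a + j) : a ∈ A, j ∈ J}` of `A` with `B` along the
ideal `J` of `B` with respect to `f : A →+* B`, as a subring of `A × B`. -/
def amalgamation {A B : Type*} [CommRing A] [CommRing B] (f : A →+* B) (J : Ideal B) :
    Subring (A × B) where
  carrier := {p | p.2 - f p.1 ∈ J}
  zero_mem' := by simp
  one_mem' := by simp
  add_mem' := fun {p q} hp hq => by
    have := J.add_mem hp hq
    simpa [add_sub_add_comm] using this
  neg_mem' := fun {p} hp => by
    show (-p).2 - f ((-p).1) ∈ J
    have key : (-p).2 - f ((-p).1) = -(p.2 - f p.1) := by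
      simp only [Prod.fst_neg, Prod.snd_neg, map_neg]; ring
    rw [key]
    exact J.neg_mem hp
  mul_mem' := fun {p q} hp hq => by
    show (p * q).2 - f ((p * q).1) ∈ J
    have key : (p * q).2 - f ((p * q).1)
        = p.2 * (q.2 - f q.1) + (p.2 - f p.1) * f q.1 := by
      simp only [Prod.fst_mul, Prod.snd_mul, map_mul]; ring
    rw [key]
    exact J.add_mem (J.mul_mem_left _ hq) (J.mul_mem_right _ hp)

/-- The natural embedding `ι_A : A → A ⋈^f J`, `a ↦ (a, f a)`. -/
def amalgIota {A B : Type*} [CommRing A] [CommRing B] (f : A →+* B) (J : Ideal B) :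
    A →+* amalgamation f J where
  toFun a := ⟨(a, f a), show (a, f a).2 - f (a, f a).1 ∈ J by simp⟩
  map_one' := Subtype.ext (by simp)
  map_mul' a b := Subtype.ext (by simp)
  map_zero' := Subtype.ext (by simp)
  map_add' a b := Subtype.ext (by simp)

/-- The extension `𝔞^e = 𝔞(A ⋈^f J)` of an ideal `𝔞` of `A` along `ι_A`. -/
noncomputable def idealExt {A B : Type*} [CommRing A] [CommRing B] (f : A →+* B)
    (J : Ideal B) (𝔞 : Ideal A) : Ideal ↥(amalgamation f J) :=
  Ideal.map (amalgIota f J) 𝔞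

/-- `kgr_A(𝔞, J)` where the ideal `J` of `B` is viewed as an `A`-module via `f`. -/
noncomputable def kgrIdeal {A B : Type*} [CommRing A] [CommRing B] (f : A →+* B)
    (J : Ideal B) (𝔞 : Ideal A) : ℕ∞ :=
  letI : Module A J := Module.compHom J f
  kgr A 𝔞 J

/-- The ideal `𝔭'^f = 𝔭 ⋈^f J = {(p, f p + j) : p ∈ 𝔭, j ∈ J}` of `A ⋈^f J`. -/
def primeAmalg {A B : Type*} [CommRing A] [CommRing B] (f : A →+* B) (J : Ideal B)
    (𝔭 : Ideal A) : Ideal ↥(amalgamation f J) where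
  carrier := {z | (z : A × B).1 ∈ 𝔭}
  zero_mem' := by simp
  add_mem' := fun {a b} ha hb => 𝔭.add_mem ha hb
  smul_mem' := fun c {z} hz => 𝔭.mul_mem_left (c : A × B).1 hz

/-- The ideal `𝔮̄^f = {(a, f a + j) : a ∈ A, j ∈ J, f a + j ∈ 𝔮}` of `A ⋈^f J`. -/
def qbarAmalg {A B : Type*} [CommRing A] [CommRing B] (f : A →+* B) (J : Ideal B)
    (𝔮 : Ideal B) : Ideal ↥(amalgamation f J) where
  carrier := {z | (z : A × B).2 ∈ 𝔮}
  zero_mem' := by simp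
  add_mem' := fun {a b} ha hb => 𝔮.add_mem ha hb
  smul_mem' := fun c {z} hz => 𝔮.mul_mem_left (c : A × B).2 hz

/-- A ring homomorphism `f : A →+* B` satisfies the going-down property. -/
def RingHom.GoesDown {A B : Type*} [CommRing A] [CommRing B] (f : A →+* B) : Prop :=
  ∀ (𝔭' 𝔭 : Ideal A), 𝔭'.IsPrime → 𝔭.IsPrime → 𝔭' ≤ 𝔭 →
    ∀ 𝔮 : Ideal B, 𝔮.IsPrime → 𝔮.comap f = 𝔭 →
      ∃ 𝔮' : Ideal B, 𝔮'.IsPrime ∧ 𝔮' ≤ 𝔮 ∧ 𝔮'.comap f = 𝔭'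


open Finset in
/-- The Koszul cochain differential on `M`-valued functions of finite subsets of `ι`, all degrees
taken together. -/
def koszulD {A M ι : Type*} [CommRing A] [AddCommGroup M] [Module A M] [LinearOrder ι]
    (x : ι → A) (g : Finset ι → M) (t : Finset ι) : M :=
  ∑ j ∈ t, ((-1 : A) ^ #{k ∈ t | k < j} * x j) • g (t.erase j)

/-- Exactness in degree `i` of the Koszul cochain complex of the subfamily of `x` indexed
by `S`. -/
def KoszulExact {A : Type*} (M : Type*) {ι : Type*} [CommRing A] [AddCommGroup M] [Module A M]
    [LinearOrder ι] (x : ι → A) (S : Finset ι) (i : ℕ) : Prop :=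
  ∀ g : Finset ι → M, (∀ t ⊆ S, t.card = i + 1 → koszulD x g t = 0) →
    ∃ h : Finset ι → M, ∀ t ⊆ S, t.card = i → koszulD x h t = g t

/-- Multiplication by `a` is injective on the `i`-th Koszul cohomology of the subfamily of `x`
indexed by `S`. -/
def KoszulSMulInj {A : Type*} (M : Type*) {ι : Type*} [CommRing A] [AddCommGroup M] [Module A M]
    [LinearOrder ι] (x : ι → A) (S : Finset ι) (a : A) (i : ℕ) : Prop :=
  ∀ g : Finset ι → M, (∀ t ⊆ S, t.card = i + 1 → koszulD x g t = 0) →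
    (∃ h : Finset ι → M, ∀ t ⊆ S, t.card = i → koszulD x h t = a • g t) →
    ∃ h : Finset ι → M, ∀ t ⊆ S, t.card = i → koszulD x h t = g t

/-- Multiplication by `a` is surjective on the `i`-th Koszul cohomology of the subfamily of `x`
indexed by `S`. -/
def KoszulSMulSurj {A : Type*} (M : Type*) {ι : Type*} [CommRing A] [AddCommGroup M] [Module A M]
    [LinearOrder ι] (x : ι → A) (S : Finset ι) (a : A) (i : ℕ) : Prop :=
  ∀ g : Finset ι → M, (∀ t ⊆ S, t.card = i + 1 → koszulD x g t = 0) →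
    ∃ z h : Finset ι → M, (∀ t ⊆ S, t.card = i + 1 → koszulD x z t = 0) ∧
      ∀ t ⊆ S, t.card = i → a • z t + koszulD x h t = g t

section Koszul

variable {A M ι : Type*} [CommRing A] [AddCommGroup M] [Module A M] [LinearOrder ι]

lemma koszulD_add (x : ι → A) (g h : Finset ι → M) (t : Finset ι) :
    koszulD x (g + h) t = koszulD x g t + koszulD x h t := by
  simp [koszulD, Finset.sum_add_distrib]

lemma koszulD_sub (x : ι → A) (g h : Finset ι → M) (t : Finset ι) :
    koszulD x (g - h) t = koszulD x g t - koszulD x h t := by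
  simp [koszulD, Finset.sum_sub_distrib, smul_sub]

lemma koszulD_smul (x : ι → A) (a : A) (g : Finset ι → M) (t : Finset ι) :
    koszulD x (a • g) t = a • koszulD x g t := by
  simp only [koszulD, Finset.smul_sum, Pi.smul_apply]
  exact Finset.sum_congr rfl fun j _ => smul_comm _ _ _

lemma koszulD_zero (x : ι → A) (t : Finset ι) : koszulD x (0 : Finset ι → M) t = 0 := by
  simp [koszulD]

lemma koszulD_congr_fun (x : ι → A) {g h : Finset ι → M} {t : Finset ι}
    (H : ∀ j ∈ t, g (t.erase j) = h (t.erase j)) : koszulD x g t = koszulD x h t :=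
  Finset.sum_congr rfl fun j hj => by rw [H j hj]

lemma koszulD_congr_seq {x y : ι → A} (g : Finset ι → M) {t : Finset ι}
    (H : ∀ j ∈ t, x j = y j) : koszulD x g t = koszulD y g t :=
  Finset.sum_congr rfl fun j hj => by rw [H j hj]

open Finset in
/-- The sign with which `j` enters the finite set `t`. -/
def koszulSign (A : Type*) [CommRing A] {ι : Type*} [LinearOrder ι] (j : ι) (t : Finset ι) : A :=
  (-1) ^ #{k ∈ t | k < j}

lemma koszulSign_mul_self (j : ι) (t : Finset ι) :
    koszulSign A j t * koszulSign A j t = 1 := by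
  rw [koszulSign, ← pow_add, ← two_mul, pow_mul]; simp

lemma koszulSign_smul_smul (j : ι) (t : Finset ι) (m : M) :
    koszulSign A j t • koszulSign A j t • m = m := by
  rw [smul_smul, koszulSign_mul_self, one_smul]

lemma koszulSign_mul_erase {j l : ι} {t : Finset ι} (hj : j ∉ t) (hl : l ∈ t) :
    koszulSign A l (insert j t) * koszulSign A j (t.erase l) =
      -(koszulSign A j t * koszulSign A l t) := by
  have hne : l ≠ j := fun h => hj (h ▸ hl)
  rcases lt_or_gt_of_ne hne with h | h
  · have h1 : (insert j t).filter (· < l) = t.filter (· < l) := by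
      rw [Finset.filter_insert, if_neg h.not_gt]
    have h2 : t.filter (· < j) = insert l ((t.erase l).filter (· < j)) := by
      conv_lhs => rw [← Finset.insert_erase hl]
      rw [Finset.filter_insert, if_pos h]
    simp only [koszulSign, h1, h2]
    rw [Finset.card_insert_of_notMem (by simp)]
    ring
  · have h1 : (insert j t).filter (· < l) = insert j (t.filter (· < l)) := by
      rw [Finset.filter_insert, if_pos h]
    have h2 : t.filter (· < j) = (t.erase l).filter (· < j) := by
      conv_lhs => rw [← Finset.insert_erase hl]
      rw [Finset.filter_insert, if_neg h.not_gt]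
    simp only [koszulSign, h1, h2]
    rw [Finset.card_insert_of_notMem (by simp [hj])]
    ring

/-- The Koszul complex with the element `x j` added is the mapping cone of multiplication
by `x j`. -/
lemma koszulD_insert (x : ι → A) (g : Finset ι → M) {j : ι} {t : Finset ι} (hj : j ∉ t) :
    koszulD x g (insert j t) = koszulSign A j t •
      (x j • g t - koszulD x (fun u => koszulSign A j u • g (insert j u)) t) := by
  have h0 : (insert j t).filter (· < j) = t.filter (· < j) := by
    rw [Finset.filter_insert, if_neg (lt_irrefl j)]
  rw [koszulD, Finset.sum_insert hj, Finset.erase_insert hj, h0, smul_sub, smul_smul,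
    sub_eq_add_neg, koszulD, Finset.smul_sum, ← Finset.sum_neg_distrib]
  congr 1
  refine Finset.sum_congr rfl fun l hl => ?_
  have hne : j ≠ l := fun h => hj (h ▸ hl)
  rw [Finset.erase_insert_of_ne hne, smul_smul, smul_smul, ← neg_smul]
  congr 1
  change koszulSign A l (insert j t) * x l = -(_ * (koszulSign A l t * x l) * _)
  have key := koszulSign_mul_erase (A := A) hj hl
  have h1 := koszulSign_mul_self (A := A) j (t.erase l)
  linear_combination (koszulSign A j (t.erase l) * x l) * key -
    (koszulSign A l (insert j t) * x l) * h1

/-- The cochain on the enlarged family with components `u` and `v` in the mapping cone. -/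
def koszulGlue (A : Type*) {M ι : Type*} [CommRing A] [AddCommGroup M] [Module A M]
    [LinearOrder ι] (j : ι) (u v : Finset ι → M) (t : Finset ι) : M :=
  if j ∈ t then koszulSign A j (t.erase j) • v (t.erase j) else u t

lemma koszulGlue_of_notMem (j : ι) (u v : Finset ι → M) {t : Finset ι} (hj : j ∉ t) :
    koszulGlue A j u v t = u t := if_neg hj

lemma koszulGlue_insert (j : ι) (u v : Finset ι → M) {t : Finset ι} (hj : j ∉ t) :
    koszulGlue A j u v (insert j t) = koszulSign A j t • v t := by
  rw [koszulGlue, if_pos (Finset.mem_insert_self _ _), Finset.erase_insert hj]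

lemma koszulD_glue_of_notMem (x : ι → A) (j : ι) (u v : Finset ι → M) {t : Finset ι}
    (hj : j ∉ t) : koszulD x (koszulGlue A j u v) t = koszulD x u t :=
  koszulD_congr_fun x fun _ _ => koszulGlue_of_notMem j u v fun h => hj (Finset.mem_of_mem_erase h)

lemma koszulD_glue_insert (x : ι → A) (j : ι) (u v : Finset ι → M) {t : Finset ι}
    (hj : j ∉ t) : koszulD x (koszulGlue A j u v) (insert j t) =
      koszulSign A j t • (x j • u t - koszulD x v t) := by
  rw [koszulD_insert x _ hj, koszulGlue_of_notMem j u v hj]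
  congr 2
  refine koszulD_congr_fun x fun l _ => ?_
  have : j ∉ t.erase l := fun h => hj (Finset.mem_of_mem_erase h)
  simp only [koszulGlue_insert j u v this, koszulSign_smul_smul]

lemma forall_subset_insert_card {P : Finset ι → Prop} {S : Finset ι} {j : ι} (i : ℕ)
    (h0 : ∀ t ⊆ S, t.card = i → P t) (h1 : ∀ t ⊆ S, t.card + 1 = i → P (insert j t)) :
    ∀ t ⊆ insert j S, t.card = i → P t := by
  intro t ht hc
  by_cases hjt : j ∈ t
  · rw [← Finset.insert_erase hjt]
    refine h1 _ (Finset.subset_insert_iff.1 ht) ?_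
    rw [Finset.card_erase_add_one hjt, hc]
  · exact h0 t ((Finset.subset_insert_iff_of_notMem hjt).1 ht) hc

lemma KoszulExact.smulInj {x : ι → A} {S : Finset ι} {j : ι} {i : ℕ} (hj : j ∉ S)
    (H : KoszulExact M x (insert j S) i) : KoszulSMulInj M x S (x j) i := by
  rintro g hg ⟨h, hh⟩
  obtain ⟨w, hw⟩ := H (koszulGlue A j g h) <| forall_subset_insert_card _
    (fun t ht hc => by
      rw [koszulD_glue_of_notMem _ _ _ _ (fun h => hj (ht h)), hg t ht hc])
    (fun t ht hc => by
      rw [koszulD_glue_insert _ _ _ _ (fun h => hj (ht h)), hh t ht (by omega), sub_self,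
        smul_zero])
  refine ⟨w, fun t ht hc => ?_⟩
  rw [hw t (ht.trans (Finset.subset_insert _ _)) hc,
    koszulGlue_of_notMem _ _ _ (fun h => hj (ht h))]

lemma KoszulExact.smulSurj {x : ι → A} {S : Finset ι} {j : ι} {i : ℕ} (hj : j ∉ S)
    (H : KoszulExact M x (insert j S) (i + 1)) : KoszulSMulSurj M x S (x j) i := by
  intro g hg
  obtain ⟨w, hw⟩ := H (koszulGlue A j 0 g) <| forall_subset_insert_card _
    (fun t ht hc => by
      rw [koszulD_glue_of_notMem _ _ _ _ (fun h => hj (ht h)), koszulD_zero])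
    (fun t ht hc => by
      rw [koszulD_glue_insert _ _ _ _ (fun h => hj (ht h)), hg t ht (by omega)]
      simp)
  refine ⟨w, fun t => -(koszulSign A j t • w (insert j t)), fun t ht hc => ?_, fun t ht hc => ?_⟩
  · rw [hw t (ht.trans (Finset.subset_insert _ _)) hc,
      koszulGlue_of_notMem _ _ _ (fun h => hj (ht h))]
    rfl
  · have hjt : j ∉ t := fun h => hj (ht h)
    have := hw (insert j t) (Finset.insert_subset_insert _ ht)
      (by rw [Finset.card_insert_of_notMem hjt, hc])
    rw [koszulGlue_insert _ _ _ hjt, koszulD_insert x w hjt] at this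
    have h2 := congrArg (koszulSign A j t • ·) this
    simp only [koszulSign_smul_smul] at h2
    rw [← h2, sub_eq_add_neg]
    congr 1
    simp [koszulD]

lemma koszulExact_insert {x : ι → A} {S : Finset ι} {j : ι} {i : ℕ} (hj : j ∉ S)
    (hinj : KoszulSMulInj M x S (x j) i)
    (hsurj : ∀ k, i = k + 1 → KoszulSMulSurj M x S (x j) k) :
    KoszulExact M x (insert j S) i := by
  intro g hg
  have hg0 : ∀ t ⊆ S, t.card = i + 1 → koszulD x g t = 0 :=
    fun t ht => hg t (ht.trans (Finset.subset_insert _ _))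
  have hg1 : ∀ t ⊆ S, t.card = i →
      koszulD x (fun u => koszulSign A j u • g (insert j u)) t = x j • g t := by
    intro t ht hc
    have hjt : j ∉ t := fun h => hj (ht h)
    have := hg (insert j t) (Finset.insert_subset_insert _ ht)
      (by rw [Finset.card_insert_of_notMem hjt, hc])
    rw [koszulD_insert x g hjt] at this
    have h2 := congrArg (koszulSign A j t • ·) this
    simp only [koszulSign_smul_smul, smul_zero] at h2
    exact (sub_eq_zero.1 h2).symm
  obtain ⟨h0, hh0⟩ := hinj g hg0 ⟨_, hg1⟩
  rcases i with _ | k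
  · exact ⟨h0, forall_subset_insert_card _ hh0 fun t ht hc => by omega⟩
  obtain ⟨z, w, hz, hw⟩ := hsurj k rfl (x j • h0 - fun u => koszulSign A j u • g (insert j u))
    fun t ht hc => by
      rw [koszulD_sub, koszulD_smul, hh0 t ht hc, hg1 t ht hc, sub_self]
  refine ⟨koszulGlue A j (h0 - z) w, forall_subset_insert_card _ (fun t ht hc => ?_)
    fun t ht hc => ?_⟩
  · rw [koszulD_glue_of_notMem _ _ _ _ (fun h => hj (ht h)), koszulD_sub, hh0 t ht hc,
      hz t ht hc, sub_zero]
  · have hjt : j ∉ t := fun h => hj (ht h)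
    have h1 := hw t ht (by omega)
    rw [koszulD_glue_insert _ _ _ _ hjt]
    have h2 : x j • (h0 - z) t - koszulD x w t = koszulSign A j t • g (insert j t) := by
      simp only [Pi.sub_apply, Pi.smul_apply] at h1 ⊢
      rw [smul_sub, sub_sub, h1, sub_sub_cancel]
    rw [h2, koszulSign_smul_smul]

lemma KoszulSMulInj.mul {x : ι → A} {S : Finset ι} {a b : A} {i : ℕ}
    (ha : KoszulSMulInj M x S a i) (hb : KoszulSMulInj M x S b i) :
    KoszulSMulInj M x S (a * b) i := by
  rintro g hg ⟨h, hh⟩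
  refine hb g hg (ha (b • g) (fun t ht hc => ?_) ⟨h, fun t ht hc => ?_⟩)
  · rw [koszulD_smul, hg t ht hc, smul_zero]
  · rw [hh t ht hc, mul_smul, Pi.smul_apply]

lemma KoszulSMulSurj.mul {x : ι → A} {S : Finset ι} {a b : A} {i : ℕ}
    (ha : KoszulSMulSurj M x S a i) (hb : KoszulSMulSurj M x S b i) :
    KoszulSMulSurj M x S (a * b) i := by
  intro g hg
  obtain ⟨z, h, hz, hh⟩ := ha g hg
  obtain ⟨z', h', hz', hh'⟩ := hb z hz
  refine ⟨z', a • h' + h, hz', fun t ht hc => ?_⟩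
  rw [koszulD_add, koszulD_smul, ← hh t ht hc, ← hh' t ht hc, smul_add, mul_smul, add_assoc]

lemma KoszulSMulInj.pow_succ {x : ι → A} {S : Finset ι} {a : A} {i : ℕ}
    (ha : KoszulSMulInj M x S a i) (m : ℕ) : KoszulSMulInj M x S (a ^ (m + 1)) i := by
  induction m with
  | zero => simpa using ha
  | succ m ih => rw [_root_.pow_succ]; exact ih.mul ha

lemma KoszulSMulSurj.pow_succ {x : ι → A} {S : Finset ι} {a : A} {i : ℕ}
    (ha : KoszulSMulSurj M x S a i) (m : ℕ) : KoszulSMulSurj M x S (a ^ (m + 1)) i := by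
  induction m with
  | zero => simpa using ha
  | succ m ih => rw [_root_.pow_succ]; exact ih.mul ha

lemma KoszulSMulInj.congr_seq {x y : ι → A} {S : Finset ι} {a : A} {i : ℕ}
    (H : ∀ j ∈ S, x j = y j) (hx : KoszulSMulInj M x S a i) : KoszulSMulInj M y S a i := by
  have key : ∀ (g : Finset ι → M), ∀ t ⊆ S, koszulD y g t = koszulD x g t :=
    fun g t ht => koszulD_congr_seq g fun j hj => (H j (ht hj)).symm
  rintro g hg ⟨h, hh⟩
  obtain ⟨w, hw⟩ := hx g (fun t ht hc => by rw [← key g t ht, hg t ht hc])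
    ⟨h, fun t ht hc => by rw [← key h t ht, hh t ht hc]⟩
  exact ⟨w, fun t ht hc => by rw [key w t ht, hw t ht hc]⟩

lemma KoszulSMulSurj.congr_seq {x y : ι → A} {S : Finset ι} {a : A} {i : ℕ}
    (H : ∀ j ∈ S, x j = y j) (hx : KoszulSMulSurj M x S a i) : KoszulSMulSurj M y S a i := by
  have key : ∀ (g : Finset ι → M), ∀ t ⊆ S, koszulD y g t = koszulD x g t :=
    fun g t ht => koszulD_congr_seq g fun j hj => (H j (ht hj)).symm
  intro g hg
  obtain ⟨z, h, hz, hh⟩ := hx g (fun t ht hc => by rw [← key g t ht, hg t ht hc])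
  exact ⟨z, h, fun t ht hc => by rw [key z t ht, hz t ht hc],
    fun t ht hc => by rw [key h t ht, hh t ht hc]⟩

/-- An element of the family acts as zero on the Koszul cohomology. -/
lemma exists_koszulD_eq_smul_of_mem {x : ι → A} {S : Finset ι} {l : ι} (hl : l ∈ S) {i : ℕ}
    {g : Finset ι → M} (hg : ∀ t ⊆ S, t.card = i + 1 → koszulD x g t = 0) :
    ∃ h : Finset ι → M, ∀ t ⊆ S, t.card = i → koszulD x h t = x l • g t := by
  refine ⟨koszulGlue A l (fun u => koszulSign A l u • g (insert l u)) 0, fun t ht hc => ?_⟩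
  by_cases hlt : l ∈ t
  · obtain ⟨u, hlu, rfl⟩ : ∃ u, l ∉ u ∧ t = insert l u :=
      ⟨t.erase l, Finset.notMem_erase _ _, (Finset.insert_erase hlt).symm⟩
    rw [koszulD_glue_insert _ _ _ _ hlu, koszulD_zero, sub_zero, smul_comm, koszulSign_smul_smul]
  · have := hg (insert l t) (Finset.insert_subset hl ht)
      (by rw [Finset.card_insert_of_notMem hlt, hc])
    rw [koszulD_insert x g hlt] at this
    have h2 := congrArg (koszulSign A l t • ·) this
    simp only [koszulSign_smul_smul, smul_zero] at h2
    rw [koszulD_glue_of_notMem _ _ _ _ hlt, sub_eq_zero.1 h2]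

/-- The ideal generated by the family annihilates the Koszul cohomology. -/
lemma exists_koszulD_eq_smul_of_mem_span {x : ι → A} {S : Finset ι} {a : A}
    (ha : a ∈ Ideal.span (x '' S)) {i : ℕ}
    {g : Finset ι → M} (hg : ∀ t ⊆ S, t.card = i + 1 → koszulD x g t = 0) :
    ∃ h : Finset ι → M, ∀ t ⊆ S, t.card = i → koszulD x h t = a • g t := by
  induction ha using Submodule.span_induction with
  | mem a ha =>
    obtain ⟨l, hl, rfl⟩ := ha
    exact exists_koszulD_eq_smul_of_mem hl hg
  | zero => exact ⟨0, fun t _ _ => by rw [koszulD_zero, zero_smul]⟩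
  | add a b _ _ ha hb =>
    obtain ⟨h, hh⟩ := ha
    obtain ⟨h', hh'⟩ := hb
    exact ⟨h + h', fun t ht hc => by rw [koszulD_add, hh t ht hc, hh' t ht hc, add_smul]⟩
  | smul c a _ ha =>
    obtain ⟨h, hh⟩ := ha
    exact ⟨c • h, fun t ht hc => by rw [koszulD_smul, hh t ht hc, smul_smul, smul_eq_mul]⟩

/-- The Koszul complex of the subfamily of `x` indexed by `S` is exact in degrees below `k`. -/
def KoszulExactBelow {A : Type*} (M : Type*) {ι : Type*} [CommRing A] [AddCommGroup M]
    [Module A M] [LinearOrder ι] (x : ι → A) (S : Finset ι) (k : ℕ) : Prop :=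
  ∀ i < k, KoszulExact M x S i

lemma KoszulExactBelow.insert_index {x : ι → A} {S : Finset ι} {k : ℕ} (H : KoszulExactBelow M x S k)
    (j : ι) : KoszulExactBelow M x (insert j S) k := by
  by_cases hj : j ∈ S
  · rwa [Finset.insert_eq_of_mem hj]
  intro i hi
  refine koszulExact_insert hj (fun g hg _ => H i hi g hg) fun m hm g hg => ?_
  obtain ⟨h, hh⟩ := H m (by omega) g hg
  exact ⟨0, h, fun t _ _ => koszulD_zero x t, fun t ht hc => by simp [hh t ht hc]⟩

lemma KoszulExactBelow.of_insert {x : ι → A} {S : Finset ι} {k : ℕ} {j : ι}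
    (hx : x j ∈ Ideal.span (x '' S)) (H : KoszulExactBelow M x (insert j S) k) :
    KoszulExactBelow M x S k := by
  by_cases hj : j ∈ S
  · rwa [Finset.insert_eq_of_mem hj] at H
  exact fun i hi g hg => (H i hi).smulInj hj g hg (exists_koszulD_eq_smul_of_mem_span hx hg)

lemma KoszulExactBelow.union {x : ι → A} {S : Finset ι} {k : ℕ} (H : KoszulExactBelow M x S k)
    (T : Finset ι) : KoszulExactBelow M x (T ∪ S) k := by
  induction T using Finset.induction_on with
  | empty => simpa using H
  | insert j T _ ih => rw [Finset.insert_union]; exact ih.insert_index j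

lemma KoszulExactBelow.of_union {x : ι → A} {S : Finset ι} {k : ℕ} {T : Finset ι}
    (hx : ∀ j ∈ T, x j ∈ Ideal.span (x '' S)) (H : KoszulExactBelow M x (T ∪ S) k) :
    KoszulExactBelow M x S k := by
  induction T using Finset.induction_on with
  | empty => simpa using H
  | insert j T _ ih =>
    rw [Finset.insert_union] at H
    refine ih (fun l hl => hx l (Finset.mem_insert_of_mem hl)) (H.of_insert ?_)
    exact Ideal.span_mono (Set.image_mono (by simp)) (hx j (Finset.mem_insert_self _ _))

lemma KoszulExactBelow.pow_insert {x y : ι → A} {S : Finset ι} {k m : ℕ} {j : ι} (hj : j ∉ S)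
    (hy : ∀ l ∈ S, x l = y l) (hyj : y j = x j ^ (m + 1))
    (H : KoszulExactBelow M x (insert j S) k) :
    KoszulExactBelow M y (insert j S) k := by
  intro i hi
  refine koszulExact_insert hj ?_ ?_
  · rw [hyj]
    exact (((H i hi).smulInj hj).pow_succ m).congr_seq hy
  · rintro i rfl
    rw [hyj]
    exact (((H _ hi).smulSurj hj).pow_succ m).congr_seq hy

lemma KoszulExactBelow.pow {x : ι → A} {S : Finset ι} {k : ℕ} (m : ℕ)
    (H : KoszulExactBelow M x S k) : KoszulExactBelow M (fun j => x j ^ (m + 1)) S k := by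
  have key : ∀ T ⊆ S,
      KoszulExactBelow M (fun j => if j ∈ T then x j ^ (m + 1) else x j) S k := by
    intro T
    induction T using Finset.induction_on with
    | empty => simpa using H
    | insert j T hj ih =>
      intro hT
      have hjS : j ∈ S := hT (Finset.mem_insert_self _ _)
      have h1 := ih ((Finset.subset_insert _ _).trans hT)
      rw [← Finset.insert_erase hjS] at h1 ⊢
      refine h1.pow_insert (m := m) (Finset.notMem_erase _ _) (fun l hl => ?_) ?_
      · simp [Finset.ne_of_mem_erase hl]
      · simp [hj]
  have h1 := key S subset_rfl
  intro i hi g hg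
  have hD : ∀ (g : Finset ι → M), ∀ t ⊆ S, koszulD (fun j => x j ^ (m + 1)) g t =
      koszulD (fun j => if j ∈ S then x j ^ (m + 1) else x j) g t :=
    fun g t ht => koszulD_congr_seq g fun j hj => by rw [if_pos (ht hj)]
  obtain ⟨h, hh⟩ := h1 i hi g fun t ht hc => by rw [← hD g t ht, hg t ht hc]
  exact ⟨h, fun t ht hc => by rw [hD h t ht, hh t ht hc]⟩

lemma koszulD_map {κ : Type*} [LinearOrder κ] (e : κ ↪o ι) (x : ι → A) (g : Finset ι → M)
    (t : Finset κ) : koszulD x g (t.map e.toEmbedding) =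
      koszulD (x ∘ e) (fun u => g (u.map e.toEmbedding)) t := by
  rw [koszulD, Finset.sum_map]
  refine Finset.sum_congr rfl fun j _ => ?_
  rw [← Finset.map_erase, Finset.filter_map, Finset.card_map]
  simp

lemma koszulExact_map_iff {κ : Type*} [LinearOrder κ] [Fintype κ] (e : κ ↪o ι) (x : ι → A)
    (i : ℕ) : KoszulExact M x (Finset.univ.map e.toEmbedding) i ↔
      KoszulExact M (x ∘ e) Finset.univ i := by
  have hpre : ∀ t : Finset κ,
      (t.map e.toEmbedding).preimage e e.injective.injOn = t := fun t => by
    ext a; simp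
  have hsub : ∀ {P : Finset ι → Prop}, (∀ t ⊆ Finset.univ.map e.toEmbedding, P t) ↔
      ∀ t : Finset κ, P (t.map e.toEmbedding) := fun {P} =>
    ⟨fun h t => h _ (Finset.map_subset_map.2 (Finset.subset_univ t)), fun h t ht => by
      obtain ⟨u, -, rfl⟩ := Finset.subset_map_iff.1 ht
      exact h u⟩
  simp only [KoszulExact, hsub, Finset.card_map, koszulD_map, Finset.subset_univ, true_imp_iff]
  constructor
  · intro H g hg
    obtain ⟨h, hh⟩ := H (fun u => g (u.preimage e e.injective.injOn)) (by simpa only [hpre] using hg)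
    exact ⟨_, fun t hc => by rw [hh t hc, hpre]⟩
  · intro H g hg
    obtain ⟨h, hh⟩ := H (fun u => g (u.map e.toEmbedding)) hg
    exact ⟨fun u => h (u.preimage e e.injective.injOn), by simpa only [hpre] using hh⟩

lemma KoszulExactBelow.of_mem_span {m n k : ℕ} {y : Fin m → A} {x : Fin n → A}
    (hy : ∀ j, y j ∈ Ideal.span (Set.range x)) (H : KoszulExactBelow M y Finset.univ k) :
    KoszulExactBelow M x Finset.univ k := by
  let z : Fin (n + m) → A := Fin.append x y
  let e₁ : Fin n ↪o Fin (n + m) := Fin.castAddOrderEmb m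
  let e₂ : Fin m ↪o Fin (n + m) := Fin.natAddOrderEmb n
  have h₁ : z ∘ e₁ = x := funext fun j => Fin.append_left x y j
  have h₂ : z ∘ e₂ = y := funext fun j => Fin.append_right x y j
  have H₂ : KoszulExactBelow M z (Finset.univ.map e₂.toEmbedding) k := fun i hi => by
    rw [koszulExact_map_iff, h₂]; exact H i hi
  have H₁ : KoszulExactBelow M z (Finset.univ.map e₁.toEmbedding) k := by
    refine KoszulExactBelow.of_union (T := Finset.univ.map e₂.toEmbedding) (fun j hj => ?_) ?_
    · obtain ⟨l, -, rfl⟩ := Finset.mem_map.1 hj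
      have : z '' (Finset.univ.map e₁.toEmbedding : Finset _) = Set.range x := by
        rw [← h₁]; simp [Set.range_comp]
      rw [this]
      have hl : z (e₂.toEmbedding l) = y l := congrFun h₂ l
      rw [hl]
      exact hy l
    · rw [Finset.union_comm]; exact H₂.union _
  intro i hi
  have := H₁ i hi
  rwa [koszulExact_map_iff, h₁] at this

lemma koszulMap_apply {n : ℕ} (x : Fin n → A) (i : ℕ) (g : Finset (Fin n) → M)
    (t : {s : Finset (Fin n) // s.card = i + 1}) :
    koszulMap A M x i (fun s => g s.1) t = koszulD x g t.1 := by
  rw [koszulD, ← Finset.sum_attach]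
  rfl

lemma koszulCohomologyNeZero_iff {n : ℕ} (x : Fin n → A) (i : ℕ) :
    koszulCohomologyNeZero A M x i ↔ ¬ KoszulExact M x Finset.univ i := by
  have hext : ∀ {i : ℕ} (g : {s : Finset (Fin n) // s.card = i} → M),
      ∃ G : Finset (Fin n) → M, g = fun s => G s.1 := fun {i} g =>
    ⟨fun s => if hs : s.card = i then g ⟨s, hs⟩ else 0, funext fun s => by simp [s.2]⟩
  cases i with
  | zero =>
    refine not_congr ⟨fun H g hg => ⟨0, fun t _ hc => ?_⟩, fun H => ?_⟩
    · have h1 : (fun s : {s : Finset (Fin n) // s.card = 0} => g s.1) ∈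
          LinearMap.ker (koszulMap A M x 0) := by
        rw [LinearMap.mem_ker]
        exact funext fun t => by rw [koszulMap_apply, hg t.1 (Finset.subset_univ _) t.2]; rfl
      rw [H, Submodule.mem_bot] at h1
      rw [koszulD_zero]
      exact (congrFun h1 ⟨t, hc⟩).symm
    · rw [eq_bot_iff]
      intro g hg
      obtain ⟨G, rfl⟩ := hext g
      obtain ⟨h, hh⟩ := H G fun t _ hc => by
        rw [← koszulMap_apply x 0 G ⟨t, hc⟩, LinearMap.mem_ker.1 hg]; rfl
      rw [Submodule.mem_bot]
      refine funext fun t => ?_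
      rw [← hh t.1 (Finset.subset_univ _) t.2, Finset.card_eq_zero.1 t.2]
      simp [koszulD]
  | succ i =>
    refine not_congr ⟨fun H g hg => ?_, fun H g hg => ?_⟩
    · obtain ⟨h, hh⟩ := H (x := fun s => g s.1) (LinearMap.mem_ker.2 <| funext fun t => by
        rw [koszulMap_apply, hg t.1 (Finset.subset_univ _) t.2]; rfl)
      obtain ⟨h, rfl⟩ := hext h
      exact ⟨h, fun t _ hc => by rw [← koszulMap_apply x i h ⟨t, hc⟩, hh]⟩
    · obtain ⟨G, rfl⟩ := hext g
      obtain ⟨h, hh⟩ := H G fun t _ hc => by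
        rw [← koszulMap_apply x _ G ⟨t, hc⟩, LinearMap.mem_ker.1 hg]; rfl
      exact ⟨fun s => h s.1, funext fun t => by
        rw [koszulMap_apply, hh t.1 (Finset.subset_univ _) t.2]⟩

lemma natCast_le_kgrSeq_iff {n : ℕ} (x : Fin n → A) (k : ℕ) :
    (k : ℕ∞) ≤ kgrSeq A M x ↔ KoszulExactBelow M x Finset.univ k := by
  simp only [kgrSeq, le_sInf_iff, Set.mem_ofPred_eq, KoszulExactBelow]
  constructor
  · intro H i hi
    by_contra h
    exact hi.not_ge (by exact_mod_cast H i ⟨i, rfl, (koszulCohomologyNeZero_iff x i).2 h⟩)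
  · rintro H _ ⟨i, rfl, hi⟩
    by_contra! h
    exact (koszulCohomologyNeZero_iff x i).1 hi (H i (by exact_mod_cast h))

lemma kgrSeq_le_kgrSeq {A' M' : Type*} [CommRing A'] [AddCommGroup M'] [Module A' M'] {m n : ℕ}
    {y : Fin m → A} {x : Fin n → A'}
    (H : ∀ k, KoszulExactBelow M y Finset.univ k → KoszulExactBelow M' x Finset.univ k) :
    kgrSeq A M y ≤ kgrSeq A' M' x :=
  ENat.forall_natCast_le_iff_le.1 fun k hk =>
    (natCast_le_kgrSeq_iff x k).2 (H k ((natCast_le_kgrSeq_iff y k).1 hk))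

lemma map_koszulD {A' M' : Type*} [CommRing A'] [AddCommGroup M'] [Module A' M'] (φ : A →+* A')
    (p : M →+ M') (hp : ∀ a m, p (a • m) = φ a • p m) (x : ι → A) (g : Finset ι → M)
    (t : Finset ι) : p (koszulD x g t) = koszulD (φ ∘ x) (p ∘ g) t := by
  simp [koszulD, hp]

lemma KoszulExact.of_retract {A' M' : Type*} [CommRing A'] [AddCommGroup M'] [Module A' M']
    (φ : A →+* A') (s : M →+ M') (p : M' →+ M) (hs : ∀ a m, s (a • m) = φ a • s m)
    (hp : ∀ a m, p (φ a • m) = a • p m) (hps : ∀ m, p (s m) = m) {x : ι → A} {S : Finset ι}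
    {i : ℕ} (H : KoszulExact M' (φ ∘ x) S i) : KoszulExact M x S i := by
  intro g hg
  obtain ⟨h, hh⟩ := H (s ∘ g) fun t ht hc => by
    rw [← map_koszulD φ s hs, hg t ht hc, map_zero]
  refine ⟨p ∘ h, fun t ht hc => ?_⟩
  have h1 := congrArg p (hh t ht hc)
  rw [Function.comp_apply, hps] at h1
  rw [← h1, koszulD, koszulD, map_sum]
  refine Finset.sum_congr rfl fun j _ => ?_
  rw [Function.comp_apply, Function.comp_apply, ← hp]
  simp

lemma KoszulExact.localization {A' : Type*} [CommRing A'] [Algebra A A'] (W : Submonoid A)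
    [IsLocalization W A'] [Fintype ι] {x : ι → A} {S : Finset ι} {i : ℕ}
    (H : KoszulExact A x S i) : KoszulExact A' (algebraMap A A' ∘ x) S i := by
  intro g hg
  have hD : ∀ (g : Finset ι → A) (t : Finset ι), algebraMap A A' (koszulD x g t) =
      koszulD (algebraMap A A' ∘ x) (algebraMap A A' ∘ g) t := fun g t =>
    map_koszulD (algebraMap A A') (algebraMap A A').toAddMonoidHom (by simp) x g t
  obtain ⟨b, hb⟩ := IsLocalization.exist_integer_multiples_of_finite W g
  choose g' hg' using hb
  have hg'' : algebraMap A A' ∘ g' = algebraMap A A' (b : A) • g := funext fun t => by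
    simp [hg', Algebra.smul_def]
  have h1 : ∀ t : Finset ι, ∃ c : W, t ⊆ S → t.card = i + 1 → (c : A) * koszulD x g' t = 0 := by
    intro t
    by_cases ht : t ⊆ S ∧ t.card = i + 1
    · have : algebraMap A A' (koszulD x g' t) = 0 := by
        rw [hD, hg'', koszulD_smul, hg t ht.1 ht.2, smul_zero]
      obtain ⟨c, hc⟩ := (IsLocalization.map_eq_zero_iff W A' _).1 this
      exact ⟨c, fun _ _ => hc⟩
    · exact ⟨1, fun h h' => (ht ⟨h, h'⟩).elim⟩
  choose c hc using h1
  obtain ⟨h, hh⟩ := H ((∏ t, (c t : A)) • g') fun t ht hcard => by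
    rw [koszulD_smul, ← Finset.prod_erase_mul _ _ (Finset.mem_univ t), smul_eq_mul, mul_assoc,
      hc t ht hcard, mul_zero]
  obtain ⟨u, hu⟩ := IsLocalization.map_units A' ((∏ t, c t) * b)
  refine ⟨(↑u⁻¹ : A') • (algebraMap A A' ∘ h), fun t ht hcard => ?_⟩
  have h2 := congrFun hg'' t
  simp only [Function.comp_apply, Pi.smul_apply, smul_eq_mul] at h2
  rw [koszulD_smul, ← hD, hh t ht hcard, smul_eq_mul, Units.inv_mul_eq_iff_eq_mul, hu]
  simp only [Pi.smul_apply, smul_eq_mul, map_mul, h2, Submonoid.coe_mul,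
    Submonoid.coe_finsetProd]
  ring

lemma not_koszulExact_of_mem {n : ℕ} {I : Ideal A} (hI : I ≠ ⊤) {x : Fin n → A}
    (hx : ∀ j, x j ∈ I) : ¬ KoszulExact A x Finset.univ n := by
  intro H
  obtain ⟨h, hh⟩ := H (fun _ => 1) fun t _ hc => by
    have := t.card_le_univ
    simp at this
    omega
  refine hI ((Ideal.eq_top_iff_one I).2 ?_)
  rw [← hh Finset.univ subset_rfl (by simp)]
  exact I.sum_mem fun j _ => I.mul_mem_right _ (I.mul_mem_left _ (hx j))

end Koszul

section Height

lemma exists_prime_lt_of_colon_le {A : Type*} [CommRing A] {N : Ideal A} {b : A}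
    {p : PrimeSpectrum A} (hb : b ∈ p.asIdeal)
    (hN : N.radical.colon {b} ≤ p.asIdeal) :
    ∃ q < p, N ≤ q.asIdeal := by
  have hdisj : Disjoint (N : Set A) (p.asIdeal.primeCompl ⊔ Submonoid.powers b : Submonoid A) := by
    rw [Set.disjoint_left]
    intro c hc hc'
    obtain ⟨s, hs, _, ⟨n, rfl⟩, rfl⟩ := Submonoid.mem_sup.1 hc'
    refine hs (hN (Submodule.mem_colon_singleton.2 ⟨n + 1, ?_⟩))
    have : (s • b) ^ (n + 1) = (s ^ n * b) * (s * b ^ n) := by simp only [smul_eq_mul]; ring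
    rw [this]
    exact N.mul_mem_left _ hc
  obtain ⟨q, hq, hNq, hqd⟩ := Ideal.exists_le_prime_disjoint N _ hdisj
  rw [Set.disjoint_left] at hqd
  refine ⟨⟨q, hq⟩, lt_of_le_not_ge (fun c hc => ?_) fun h => ?_, hNq⟩
  · by_contra hcp
    exact hqd hc (Submonoid.mem_sup_left (S := p.asIdeal.primeCompl) hcp)
  · exact hqd (h hb) (Submonoid.mem_sup_right (Submonoid.mem_powers b))

/-- **Kronecker's theorem**: if chains of primes of the open subset `D(a)` of `V(N)` have length
less than `d`, then `d` elements `x i` can be modified by multiples of `a` so as to absorb `a` up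
to radical. -/
lemma exists_mem_radical_span_add_mul {A : Type*} [CommRing A] (a : A) (d : ℕ) (N : Ideal A)
    (x : Fin d → A)
    (H : ∀ l : LTSeries (PrimeSpectrum A), N ≤ l.head.asIdeal → a ∉ l.last.asIdeal →
      l.length < d) :
    ∃ y : Fin d → A, a ∈ (N ⊔ Ideal.span (Set.range fun i => x i + a * y i)).radical := by
  induction d generalizing N with
  | zero =>
    refine ⟨x, ?_⟩
    rw [Ideal.radical_eq_sInf, Ideal.mem_sInf]
    rintro q ⟨hq, hqp⟩
    by_contra ha
    exact absurd (H (RelSeries.singleton _ ⟨q, hqp⟩) (le_sup_left.trans hq) ha) (by simp)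
  | succ d ih =>
    obtain ⟨y, n, hy⟩ := ih (N ⊔ Ideal.span {x 0} ⊔ N.radical.colon {x 0}) (fun i => x i.succ) <| by
      intro l hl ha
      have hb : x 0 ∈ l.head.asIdeal :=
        hl (Ideal.mem_sup_left (Ideal.mem_sup_right (Ideal.mem_span_singleton_self _)))
      obtain ⟨q, hq, hNq⟩ := exists_prime_lt_of_colon_le hb (le_sup_right.trans hl)
      have := H (l.cons q hq) (by simpa using hNq) (by simpa using ha)
      simpa using this
    obtain ⟨u, hu, w, hw, huw⟩ := Submodule.mem_sup.1 hy
    obtain ⟨v, hv, z, hz, rfl⟩ := Submodule.mem_sup.1 hu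
    refine ⟨Fin.cons z y, ?_⟩
    rw [Ideal.radical_eq_sInf, Ideal.mem_sInf]
    rintro q ⟨hq, hqp⟩
    have hNq : N ≤ q := le_sup_left.trans hq
    have hmem : ∀ i, x i + a * (Fin.cons z y : Fin (d + 1) → A) i ∈ q := fun i =>
      hq (Ideal.mem_sup_right (Ideal.subset_span ⟨i, rfl⟩))
    have h0 : x 0 + a * z ∈ q := by simpa using hmem 0
    have hzb : z * x 0 ∈ q :=
      hqp.radical_le_iff.2 hNq (Submodule.mem_colon_singleton.1 hz)
    have hb : x 0 ∈ q := by
      refine hqp.mem_of_pow_mem 2 ?_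
      have : x 0 ^ 2 = x 0 * (x 0 + a * z) - a * (z * x 0) := by ring
      rw [this]
      exact q.sub_mem (q.mul_mem_left _ h0) (q.mul_mem_left _ hzb)
    rcases hqp.mem_or_mem ((q.add_mem_iff_right hb).1 h0) with ha | hzq
    · exact ha
    refine hqp.mem_of_pow_mem n ?_
    rw [← huw]
    refine q.add_mem (q.add_mem ?_ hzq) ?_
    · exact (sup_le hNq ((Ideal.span_singleton_le_iff_mem _).2 hb)) hv
    · refine Ideal.span_le.2 ?_ hw
      rintro _ ⟨i, rfl⟩
      simpa using hmem i.succ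

/-- In a local ring of finite dimension `d`, every finitely generated proper ideal is contained in
the radical of an ideal generated by `d` elements of the maximal ideal. -/
lemma IsLocalRing.exists_forall_mem_radical_span {A : Type*} [CommRing A] [IsLocalRing A] {d : ℕ}
    (hd : Order.height (closedPoint A) ≤ d) {n : ℕ} (x : Fin n → A)
    (hx : ∀ j, x j ∈ maximalIdeal A) :
    ∃ y : Fin d → A, (∀ i, y i ∈ maximalIdeal A) ∧
      ∀ j, x j ∈ (Ideal.span (Set.range y)).radical := by
  induction n with
  | zero => exact ⟨0, fun i => zero_mem _, fun j => j.elim0⟩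
  | succ n ih =>
    obtain ⟨y, hym, hy⟩ := ih (fun j => x j.succ) fun j => hx _
    obtain ⟨z, hz⟩ := exists_mem_radical_span_add_mul (x 0) d ⊥ y fun l _ ha => by
      have hlt : l.last < closedPoint A :=
        lt_of_le_not_ge (le_maximalIdeal l.last.isPrime.ne_top) fun h => ha (h (hx 0))
      have h1 := (Order.height_add_one_le hlt).trans hd
      have h2 := (add_le_add_left (Order.length_le_height_last (p := l)) 1).trans h1
      exact_mod_cast h2
    rw [bot_sup_eq] at hz
    refine ⟨fun i => y i + x 0 * z i,
      fun i => add_mem (hym i) (Ideal.mul_mem_right _ _ (hx 0)), fun j => ?_⟩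
    refine Fin.cases hz (fun j => ?_) j
    refine Ideal.radical_le_radical_iff.2 (Ideal.span_le.2 ?_) (hy j)
    rintro _ ⟨i, rfl⟩
    have : y i = (y i + x 0 * z i) - x 0 * z i := by ring
    rw [SetLike.mem_coe, this]
    exact sub_mem (Ideal.le_radical (Ideal.subset_span ⟨i, rfl⟩)) (Ideal.mul_mem_right _ _ hz)

lemma kgrSeq_le_height {A : Type*} [CommRing A] (p : PrimeSpectrum A) {n : ℕ} (x : Fin n → A)
    (hx : ∀ j, x j ∈ p.asIdeal) : kgrSeq A A x ≤ Order.height p := by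
  refine ENat.forall_natCast_le_iff_le.1 fun k hk => ?_
  by_contra! hlt
  obtain ⟨d, hd⟩ := ENat.ne_top_iff_exists.1 hlt.ne_top
  rw [natCast_le_kgrSeq_iff] at hk
  rw [← hd, Nat.cast_lt] at hlt
  let R := Localization.AtPrime p.asIdeal
  have hmono : StrictMono (PrimeSpectrum.comap (algebraMap A R)) := fun q q' h =>
    (IsLocalization.orderEmbedding p.asIdeal.primeCompl R).strictMono h
  have hclosed : PrimeSpectrum.comap (algebraMap A R) (IsLocalRing.closedPoint R) = p :=
    PrimeSpectrum.ext (IsLocalization.AtPrime.under_maximalIdeal R p.asIdeal)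
  have hR : Order.height (IsLocalRing.closedPoint R) ≤ d := by
    rw [hd]
    conv_rhs => rw [← hclosed]
    exact Order.height_le_height_apply_of_strictMono _ hmono _
  have hxm : ∀ j, (algebraMap A R ∘ x) j ∈ IsLocalRing.maximalIdeal R := fun j => by
    have := hx j
    rw [← hclosed] at this
    exact this
  obtain ⟨y, hym, hy⟩ := IsLocalRing.exists_forall_mem_radical_span hR _ hxm
  choose m hm using hy
  have hpow : ∀ j, (algebraMap A R ∘ x) j ^ ((∑ l, m l) + 1) ∈ Ideal.span (Set.range y) :=
    fun j => Ideal.pow_mem_of_pow_mem _ (hm j)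
      ((Finset.single_le_sum (f := m) (fun _ _ => Nat.zero_le _) (Finset.mem_univ j)).trans (Nat.le_succ _))
  have hloc : KoszulExactBelow R (algebraMap A R ∘ x) Finset.univ k := fun i hi =>
    (hk i hi).localization p.asIdeal.primeCompl
  exact not_koszulExact_of_mem (IsLocalRing.maximalIdeal.isMaximal R).ne_top hym
    ((hloc.pow _).of_mem_span hpow d hlt)

lemma kgr_le_idealHeight {A : Type*} [CommRing A] (𝔞 : Ideal A) : kgr A 𝔞 A ≤ idealHeight A 𝔞 :=
  iSup_le fun _ => iSup_le fun x => iSup_le fun hx => le_iInf fun p => le_iInf fun hp =>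
    kgrSeq_le_height p x fun j => hp (hx j)

lemma idealHeight_mono {A : Type*} [CommRing A] {𝔞 𝔟 : Ideal A} (h : 𝔞 ≤ 𝔟) :
    idealHeight A 𝔞 ≤ idealHeight A 𝔟 :=
  le_iInf fun p => le_iInf fun hp => iInf₂_le p (h.trans hp)

lemma idealHeight_asIdeal {A : Type*} [CommRing A] (p : PrimeSpectrum A) :
    idealHeight A p.asIdeal = Order.height p :=
  le_antisymm (iInf₂_le p le_rfl) (le_iInf fun _ => le_iInf fun hq => Order.height_mono hq)

end Height

section Amalgamation

variable {A B : Type*} [CommRing A] [CommRing B] (f : A →+* B) (J : Ideal B)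

/-- The projection `A ⋈^f J → A`. -/
def amalgFst : amalgamation f J →+* A := (RingHom.fst A B).comp (amalgamation f J).subtype

/-- The projection `A ⋈^f J → B`. -/
def amalgSnd : amalgamation f J →+* B := (RingHom.snd A B).comp (amalgamation f J).subtype

/-- The embedding `j ↦ (0, j)` of `J` into `A ⋈^f J`. -/
def amalgInr : J →+ amalgamation f J where
  toFun j := ⟨(0, j), show (j : B) - f 0 ∈ J by simp⟩
  map_zero' := rfl
  map_add' _ _ := Subtype.ext (by simp)

/-- The projection `(a, b) ↦ b - f a` of `A ⋈^f J` onto `J`. -/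
def amalgToIdeal : amalgamation f J →+ J where
  toFun z := ⟨(z : A × B).2 - f (z : A × B).1, z.2⟩
  map_zero' := Subtype.ext (by simp)
  map_add' _ _ := Subtype.ext (by simp [add_sub_add_comm])

lemma amalgFst_surjective : Function.Surjective (amalgFst f J) := fun a => ⟨amalgIota f J a, rfl⟩

lemma comap_amalgSnd_lt {q q' : PrimeSpectrum B} (h : q < q') (hq' : ¬ J ≤ q'.asIdeal) :
    PrimeSpectrum.comap (amalgSnd f J) q < PrimeSpectrum.comap (amalgSnd f J) q' := by
  refine lt_of_le_not_ge (fun z hz => h.le hz) fun hle => h.not_ge fun b hb => ?_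
  obtain ⟨j, hj, hjq⟩ := SetLike.not_le_iff_exists.1 hq'
  have : amalgInr f J ⟨j * b, J.mul_mem_right _ hj⟩ ∈
      (PrimeSpectrum.comap (amalgSnd f J) q).asIdeal := hle (q'.asIdeal.mul_mem_left j hb)
  exact (q.isPrime.mem_or_mem (show j * b ∈ q.asIdeal from this)).resolve_left
    fun h' => hjq (h.le h')

lemma height_le_height_comap_amalgSnd (q : PrimeSpectrum B) (hq : ¬ J ≤ q.asIdeal) :
    Order.height q ≤ Order.height (PrimeSpectrum.comap (amalgSnd f J) q) := by
  refine Order.height_le fun l hl => ?_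
  let l' : LTSeries (PrimeSpectrum (amalgamation f J)) :=
    { length := l.length
      toFun := fun i => PrimeSpectrum.comap (amalgSnd f J) (l i)
      step := fun i => comap_amalgSnd_lt f J (l.step i) fun h =>
        hq (h.trans (hl ▸ LTSeries.monotone l (Fin.le_last _))) }
  exact Order.length_le_height (p := l') (congrArg (PrimeSpectrum.comap (amalgSnd f J)) hl).le

lemma exists_eq_comap_amalgSnd (P : PrimeSpectrum (amalgamation f J))
    {j : J} (hj : amalgInr f J j ∉ P.asIdeal) :
    ∃ q : PrimeSpectrum B, ¬ J ≤ q.asIdeal ∧ P = PrimeSpectrum.comap (amalgSnd f J) q := by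
  have hmul : ∀ z : amalgamation f J, ∀ b : B, amalgInr f J (b • j) * z =
      amalgInr f J ((b * amalgSnd f J z) • j) := fun z b =>
    Subtype.ext (Prod.ext (zero_mul _) (by
      change b * (j : B) * amalgSnd f J z = b * amalgSnd f J z * (j : B); ring))
  have hmul' : ∀ b b' : B, amalgInr f J (b • j) * amalgInr f J (b' • j) =
      amalgInr f J ((b * b') • j) * amalgInr f J j := fun b b' =>
    Subtype.ext (Prod.ext rfl (by
      change b * (j : B) * (b' * (j : B)) = b * b' * (j : B) * (j : B); ring))
  let q : Ideal B :=
    { carrier := {b | amalgInr f J (b • j) ∈ P.asIdeal}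
      zero_mem' := by simp
      add_mem' := fun {b b'} hb hb' => by
        simp only [Set.mem_ofPred_eq, add_smul, map_add] at *
        exact add_mem hb hb'
      smul_mem' := fun c b hb => by
        refine (P.isPrime.mem_or_mem ?_).resolve_right hj
        have h1 := hmul' c b
        rw [smul_eq_mul, ← h1]
        exact P.asIdeal.mul_mem_left _ hb }
  have hq : ∀ b, b ∈ q ↔ amalgInr f J (b • j) ∈ P.asIdeal := fun b => Iff.rfl
  have hqp : q.IsPrime := by
    refine ⟨fun h => hj ?_, fun {b b'} hbb' => ?_⟩
    · simpa using (hq 1).1 (h ▸ Submodule.mem_top)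
    · refine P.isPrime.mem_or_mem ?_
      rw [hmul']
      exact P.asIdeal.mul_mem_right _ hbb'
  refine ⟨⟨q, hqp⟩, fun h => hj (P.isPrime.mem_of_pow_mem 2 ?_), PrimeSpectrum.ext ?_⟩
  · have h1 : amalgInr f J j ^ 2 = amalgInr f J ((j : B) • j) := by
      rw [sq]
      have := hmul (amalgInr f J j) 1
      rw [one_smul, one_mul] at this
      exact this
    rw [h1]
    exact h j.2
  · ext z
    change z ∈ P.asIdeal ↔ amalgInr f J (amalgSnd f J z • j) ∈ P.asIdeal
    have := hmul z 1
    rw [one_smul, one_mul] at this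
    rw [← this]
    exact ⟨fun h => P.asIdeal.mul_mem_left _ h, fun h => (P.isPrime.mem_or_mem h).resolve_left hj⟩

lemma idealHeight_le_idealHeight_idealExt
    (hht : ∀ 𝔮 : Ideal B, 𝔮.IsPrime → ¬ J ≤ 𝔮 →
      idealHeight A (𝔮.comap f) ≤ idealHeight B 𝔮) (𝔞 : Ideal A) :
    idealHeight A 𝔞 ≤ idealHeight (amalgamation f J) (idealExt f J 𝔞) := by
  refine le_iInf fun P => le_iInf fun hP => ?_
  have h𝔞 : 𝔞 ≤ P.asIdeal.comap (amalgIota f J) := Ideal.map_le_iff_le_comap.1 hP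
  by_cases h : ∀ j : J, amalgInr f J j ∈ P.asIdeal
  · have hPeq : P = PrimeSpectrum.comap (amalgFst f J) (PrimeSpectrum.comap (amalgIota f J) P) := by
      refine PrimeSpectrum.ext (Ideal.ext fun z => ?_)
      change z ∈ P.asIdeal ↔ amalgIota f J (amalgFst f J z) ∈ P.asIdeal
      have : z = amalgIota f J (amalgFst f J z) + amalgInr f J (amalgToIdeal f J z) :=
        Subtype.ext (Prod.ext (add_zero _).symm (add_sub_cancel _ _).symm)
      conv_lhs => rw [this]
      exact P.asIdeal.add_mem_iff_left (h _)
    rw [hPeq]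
    refine le_trans (iInf₂_le (PrimeSpectrum.comap (amalgIota f J) P) h𝔞) ?_
    exact Order.height_le_height_apply_of_strictMono _
      (RingHom.strictMono_comap_of_surjective (amalgFst_surjective f J)) _
  · push Not at h
    obtain ⟨j, hj⟩ := h
    obtain ⟨q, hJq, rfl⟩ := exists_eq_comap_amalgSnd f J P hj
    calc idealHeight A 𝔞 ≤ idealHeight A (q.asIdeal.comap f) := idealHeight_mono h𝔞
      _ ≤ idealHeight B q.asIdeal := hht _ q.isPrime hJq
      _ = Order.height q := idealHeight_asIdeal q
      _ ≤ _ := height_le_height_comap_amalgSnd f J q hJq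

/-- The Koszul grade of an extended ideal does not exceed that of the ideal on a retract. -/
lemma kgr_map_le_of_retract {A R M : Type*} [CommRing A] [CommRing R] [AddCommGroup M]
    [Module A M] (φ : A →+* R) (s : M →+ R) (p : R →+ M) (hs : ∀ a m, s (a • m) = φ a • s m)
    (hp : ∀ a m, p (φ a • m) = a • p m) (hps : ∀ m, p (s m) = m) (𝔞 : Ideal A) :
    kgr R (𝔞.map φ) R ≤ kgr A 𝔞 M := by
  refine iSup_le fun m => iSup_le fun y => iSup_le fun hy => ?_
  choose T hT hyT using fun j => Submodule.mem_span_finite_of_mem_span (hy j)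
  classical
  obtain ⟨T', hT', hTT'⟩ := Finset.subset_set_image_iff.1
    (show ((Finset.univ.biUnion T : Finset R) : Set R) ⊆ φ '' 𝔞 by simpa using hT)
  let x : Fin T'.card → A := fun i => T'.equivFin.symm i
  have hx : ∀ i, x i ∈ 𝔞 := fun i => hT' (T'.equivFin.symm i).2
  have hyx : ∀ j, y j ∈ Ideal.span (Set.range (φ ∘ x)) := fun j => by
    refine Ideal.span_mono ?_ (hyT j)
    intro r hr
    have : r ∈ T'.image φ := hTT' ▸ Finset.mem_biUnion.2 ⟨j, Finset.mem_univ _, hr⟩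
    obtain ⟨a, ha, rfl⟩ := Finset.mem_image.1 this
    exact ⟨T'.equivFin ⟨a, ha⟩, by simp [x]⟩
  refine le_trans (kgrSeq_le_kgrSeq fun k hk i hi => ?_)
    (le_iSup_of_le _ (le_iSup_of_le x (le_iSup_of_le hx le_rfl)))
  exact (hk.of_mem_span hyx i hi).of_retract φ s p hs hp hps

lemma kgr_idealExt_le_kgr (𝔞 : Ideal A) :
    kgr (amalgamation f J) (idealExt f J 𝔞) (amalgamation f J) ≤ kgr A 𝔞 A :=
  kgr_map_le_of_retract (amalgIota f J) (amalgIota f J).toAddMonoidHom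
    (amalgFst f J).toAddMonoidHom (fun a m => map_mul (amalgIota f J) a m)
    (fun a z => map_mul (amalgFst f J) (amalgIota f J a) z) (fun _ => rfl) 𝔞

lemma kgr_idealExt_le_kgrIdeal (𝔞 : Ideal A) :
    kgr (amalgamation f J) (idealExt f J 𝔞) (amalgamation f J) ≤ kgrIdeal f J 𝔞 := by
  let : Module A J := Module.compHom J f
  refine kgr_map_le_of_retract (amalgIota f J) (amalgInr f J) (amalgToIdeal f J) (fun a j => ?_)
    (fun a z => ?_) (fun j => ?_) 𝔞
  · exact Subtype.ext (Prod.ext (mul_zero a).symm rfl)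
  · refine Subtype.ext ?_
    change f a * (z : A × B).2 - f (a * (z : A × B).1) =
      f a * ((z : A × B).2 - f (z : A × B).1)
    rw [map_mul, mul_sub]
  · refine Subtype.ext ?_
    change (j : B) - f 0 = j
    rw [map_zero, sub_zero]

end Amalgamation

/-- Let `𝒜` be a non-empty class of ideals of `A`, and assume
`height f⁻¹(𝔮) ≤ height 𝔮` for every `𝔮 ∈ Spec(B) \ V(J)`. If `A⋈^f J` is Cohen-Macaulay
in the sense of `𝒜^e`, then `A` is Cohen-Macaulay in the sense of `𝒜` and
`kgr_A(𝔞, J) ≥ height 𝔞` for every `𝔞 ∈ 𝒜`. -/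
theorem isCMSense_of_isCMSense_ext_of_height_comap_le {A B : Type*} [CommRing A]
    [CommRing B] (f : A →+* B) (J : Ideal B) (𝒜 : Set (Ideal A)) (h𝒜 : 𝒜.Nonempty)
    (hht : ∀ 𝔮 : Ideal B, 𝔮.IsPrime → ¬ J ≤ 𝔮 →
      idealHeight A (𝔮.comap f) ≤ idealHeight B 𝔮)
    (hCM : IsCMSense ↥(amalgamation f J) (idealExt f J '' 𝒜)) :
    IsCMSense A 𝒜 ∧ ∀ 𝔞 ∈ 𝒜, idealHeight A 𝔞 ≤ kgrIdeal f J 𝔞 := by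
  have key : ∀ 𝔞 ∈ 𝒜, idealHeight A 𝔞 ≤
      kgr (amalgamation f J) (idealExt f J 𝔞) (amalgamation f J) := fun 𝔞 h𝔞 =>
    (idealHeight_le_idealHeight_idealExt f J hht 𝔞).trans_eq (hCM _ ⟨𝔞, h𝔞, rfl⟩)
  exact ⟨fun 𝔞 h𝔞 => le_antisymm ((key 𝔞 h𝔞).trans (kgr_idealExt_le_kgr f J 𝔞))
    (kgr_le_idealHeight 𝔞), fun 𝔞 h𝔞 => (key 𝔞 h𝔞).trans (kgr_idealExt_le_kgrIdeal f J 𝔞)⟩
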